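/- Let R be a supertropical domain and A ∈ M_n(R) semi-idempotent, i.e., A² = βA for some tangible β ∈ T. Then μ(A) = 1; explicitly, 1 is a leading index of A: writing f_A = λ^n + Σ_{k=1}^n α_k λ^{n-k} and noting α_1 = trace(A) = Σ_i A(i,i), one has trace(A)^k ≥ν α_k for every k ∈ {1,…,n}. -/

import Mathlib

/-- A supertropical semiring structure on a commutative semiring `R`, given by the ghost
map `ν`.  The ghost ideal is `Set.range ν`; the tangible elements are those not in it. -/
structure IsSupertropical {R : Type*} [CommSemiring R] (ν : R → R) : Prop where
  idem : ∀ a : R, ν (ν a) = ν a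
  addMap : ∀ a b : R, ν (a + b) = ν a + ν b
  mulMap : ∀ a b : R, ν (a * b) = ν a * ν b
  ghost : ∀ a : R, ν a = a + a
  addEq : ∀ a b : R, ν a = ν b → a + b = ν a
  addNe : ∀ a b : R, ν a ≠ ν b → a + b = a ∨ a + b = b

/-- A supertropical domain: a supertropical semiring in which the tangible elements
`T = R \ ν(R)` form a cancellative multiplicative monoid and `ν` maps `T` onto `ν(R) \ {0}`. -/
structure IsSupertropicalDomain {R : Type*} [CommSemiring R] (ν : R → R)
    extends IsSupertropical ν : Prop where
  oneTangible : (1 : R) ∉ Set.range ν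
  mulTangible : ∀ a b : R, a ∉ Set.range ν → b ∉ Set.range ν → a * b ∉ Set.range ν
  cancelTangible : ∀ a b c : R, a ∉ Set.range ν → b ∉ Set.range ν → c ∉ Set.range ν →
    a * b = a * c → b = c
  onto : ∀ g ∈ Set.range ν, g ≠ 0 → ∃ t ∉ Set.range ν, ν t = g

/-- The supertropical determinant (permanent) of a square matrix. -/
noncomputable def stPer {m : Type*} [Fintype m] [DecidableEq m] {R : Type*} [CommSemiring R]
    (A : Matrix m m R) : R :=
  ∑ σ : Equiv.Perm m, ∏ i, A i (σ i)

/-- The supertropical characteristic polynomial `|λI + A|`: the permanent of `λI + A`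
computed in the polynomial semiring `R[λ]`. -/
noncomputable def stCharPoly {m : Type*} [Fintype m] [DecidableEq m] {R : Type*}
    [CommSemiring R] (A : Matrix m m R) : Polynomial R :=
  ∑ σ : Equiv.Perm m, ∏ i, ((if i = σ i then Polynomial.X else 0) + Polynomial.C (A i (σ i)))


/-- `a` is at most `b` with respect to the ghost map `ν`. -/
def NuLE {R : Type*} [Add R] (ν : R → R) (a b : R) : Prop := ν b + ν a = ν b

namespace IsSupertropical

variable {R : Type*} [CommSemiring R] {ν : R → R}

theorem map_zero (h : IsSupertropical ν) : ν 0 = 0 := by rw [h.ghost, add_zero]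

theorem eq_zero_of_map (h : IsSupertropical ν) {a : R} (ha : ν a = 0) : a = 0 := by
  have := h.addEq a 0 (by rw [ha, h.map_zero])
  rwa [add_zero, ha] at this

theorem add_self_map (h : IsSupertropical ν) (a : R) : ν a + ν a = ν a := by
  rw [← h.ghost, h.idem]

theorem nuLE_refl (h : IsSupertropical ν) (a : R) : NuLE ν a a := h.add_self_map a

theorem nuLE_of_map_eq (h : IsSupertropical ν) {a b : R} (hab : ν a = ν b) : NuLE ν a b := by
  rw [NuLE, hab, h.add_self_map]

theorem nuLE_trans {a b c : R} (hab : NuLE ν a b) (hbc : NuLE ν b c) : NuLE ν a c := by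
  unfold NuLE at *
  rw [← hbc, add_assoc, hab]

theorem zero_nuLE (h : IsSupertropical ν) (a : R) : NuLE ν 0 a := by
  rw [NuLE, h.map_zero, add_zero]

theorem eq_zero_of_nuLE_zero (h : IsSupertropical ν) {a : R} (ha : NuLE ν a 0) : a = 0 := by
  rw [NuLE, h.map_zero, zero_add] at ha
  exact h.eq_zero_of_map ha

theorem nuLE_total (h : IsSupertropical ν) (a b : R) : NuLE ν a b ∨ NuLE ν b a := by
  by_cases hab : ν a = ν b
  · exact .inl (h.nuLE_of_map_eq hab)
  · rcases h.addNe (ν a) (ν b) (by rwa [h.idem, h.idem]) with h1 | h1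
    · exact .inr h1
    · exact .inl (by rw [NuLE, add_comm, h1])

theorem nuLE_antisymm {a b : R} (hab : NuLE ν a b) (hba : NuLE ν b a) : ν a = ν b := by
  unfold NuLE at *
  rw [← hba, add_comm, hab]

theorem mul_nuLE_mul_left (h : IsSupertropical ν) (c : R) {a b : R} (hab : NuLE ν a b) :
    NuLE ν (c * a) (c * b) := by
  unfold NuLE at *
  rw [h.mulMap, h.mulMap, ← mul_add, hab]

theorem mul_nuLE_mul (h : IsSupertropical ν) {a b c d : R} (hab : NuLE ν a b)
    (hcd : NuLE ν c d) : NuLE ν (a * c) (b * d) := by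
  refine nuLE_trans (h.mul_nuLE_mul_left a hcd) ?_
  rw [mul_comm a, mul_comm b]
  exact h.mul_nuLE_mul_left d hab

theorem pow_nuLE_pow (h : IsSupertropical ν) {a b : R} (hab : NuLE ν a b) (m : ℕ) :
    NuLE ν (a ^ m) (b ^ m) := by
  induction m with
  | zero => simpa using h.nuLE_refl 1
  | succ m ih => simpa only [pow_succ] using h.mul_nuLE_mul ih hab

theorem add_nuLE (h : IsSupertropical ν) {a b c : R} (ha : NuLE ν a c) (hb : NuLE ν b c) :
    NuLE ν (a + b) c := by
  unfold NuLE at *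
  rw [h.addMap, ← add_assoc, ha, hb]

theorem nuLE_add_right (h : IsSupertropical ν) (a b : R) : NuLE ν a (a + b) := by
  rw [NuLE, h.addMap, add_right_comm, h.add_self_map]

theorem sum_nuLE (h : IsSupertropical ν) {ι : Type*} {s : Finset ι} {f : ι → R} {c : R}
    (hf : ∀ i ∈ s, NuLE ν (f i) c) : NuLE ν (∑ i ∈ s, f i) c :=
  Finset.sum_induction f (NuLE ν · c) (fun _ _ => h.add_nuLE) (h.zero_nuLE c) hf

theorem nuLE_sum (h : IsSupertropical ν) {ι : Type*} {s : Finset ι} (f : ι → R) {i : ι}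
    (hi : i ∈ s) : NuLE ν (f i) (∑ j ∈ s, f j) := by
  classical
  rw [← Finset.add_sum_erase s f hi]
  exact h.nuLE_add_right _ _

theorem exists_sum_nuLE (h : IsSupertropical ν) {ι : Type*} {s : Finset ι} (hs : s.Nonempty)
    (f : ι → R) : ∃ i ∈ s, NuLE ν (∑ j ∈ s, f j) (f i) := by
  induction hs using Finset.Nonempty.cons_induction with
  | singleton i => exact ⟨i, by simp, by simpa using h.nuLE_refl (f i)⟩
  | cons i s hi hs ih =>
    obtain ⟨j, hj, hle⟩ := ih
    rw [Finset.sum_cons]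
    rcases h.nuLE_total (f i) (f j) with hij | hij
    · exact ⟨j, by simp [hj], h.add_nuLE hij hle⟩
    · exact ⟨i, by simp, h.add_nuLE (h.nuLE_refl _) (nuLE_trans hle hij)⟩

theorem prod_nuLE_prod (h : IsSupertropical ν) {ι : Type*} {s : Finset ι} {f g : ι → R}
    (hfg : ∀ i ∈ s, NuLE ν (f i) (g i)) : NuLE ν (∏ i ∈ s, f i) (∏ i ∈ s, g i) := by
  classical
  induction s using Finset.induction_on with
  | empty => simpa using h.nuLE_refl 1
  | insert i s hi ih =>
    rw [Finset.prod_insert hi, Finset.prod_insert hi]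
    exact h.mul_nuLE_mul (hfg i (Finset.mem_insert_self i s))
      (ih fun j hj => hfg j (Finset.mem_insert_of_mem hj))

theorem entry_mul_nuLE (h : IsSupertropical ν) {m : Type*} [Fintype m] (B C : Matrix m m R)
    (i j l : m) : NuLE ν (B i j * C j l) ((B * C) i l) := by
  rw [Matrix.mul_apply]
  exact h.nuLE_sum (fun j => B i j * C j l) (Finset.mem_univ j)

/-- The weight of a walk of length `p` is bounded by an entry of the `p`-th power. -/
theorem walk_nuLE (h : IsSupertropical ν) {m : Type*} [Fintype m] [DecidableEq m]
    (A : Matrix m m R) (v : ℕ → m) (p : ℕ) :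
    NuLE ν (∏ t ∈ Finset.range p, A (v t) (v (t + 1))) ((A ^ p) (v 0) (v p)) := by
  induction p with
  | zero => simpa using h.nuLE_refl 1
  | succ p ih =>
    rw [Finset.prod_range_succ, pow_succ]
    exact nuLE_trans (h.mul_nuLE_mul ih (h.nuLE_refl _)) (h.entry_mul_nuLE _ _ _ _ _)

end IsSupertropical

namespace IsSupertropicalDomain

open IsSupertropical

variable {R : Type*} [CommSemiring R] {ν : R → R}

theorem exists_tangible (h : IsSupertropicalDomain ν) {a : R} (ha : a ≠ 0) :
    ∃ t ∉ Set.range ν, ν t = ν a :=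
  h.onto _ ⟨a, rfl⟩ fun h0 => ha (h.eq_zero_of_map h0)

theorem zero_mem_range (h : IsSupertropicalDomain ν) : (0 : R) ∈ Set.range ν :=
  ⟨0, h.map_zero⟩

theorem ne_zero_of_tangible (h : IsSupertropicalDomain ν) {a : R} (ha : a ∉ Set.range ν) :
    a ≠ 0 := by
  rintro rfl
  exact ha h.zero_mem_range

theorem mul_ne_zero (h : IsSupertropicalDomain ν) {a b : R} (ha : a ≠ 0) (hb : b ≠ 0) :
    a * b ≠ 0 := by
  obtain ⟨a', ha', hνa⟩ := h.exists_tangible ha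
  obtain ⟨b', hb', hνb⟩ := h.exists_tangible hb
  intro h0
  refine h.ne_zero_of_tangible (h.mulTangible a' b' ha' hb') (h.eq_zero_of_map ?_)
  rw [h.mulMap, hνa, hνb, ← h.mulMap, h0, h.map_zero]

theorem map_eq_of_mul_left (h : IsSupertropicalDomain ν) {a b c : R} (hc : c ≠ 0)
    (habc : ν (c * a) = ν (c * b)) : ν a = ν b := by
  by_cases ha : a = 0
  · subst ha
    by_contra hne
    have hb : b ≠ 0 := fun hb => hne (by rw [hb])
    rw [mul_zero, h.map_zero] at habc
    exact h.mul_ne_zero hc hb (h.eq_zero_of_map habc.symm)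
  by_cases hb : b = 0
  · subst hb
    rw [mul_zero, h.map_zero] at habc
    exact absurd (h.eq_zero_of_map habc) (h.mul_ne_zero hc ha)
  obtain ⟨a', ha', hνa⟩ := h.exists_tangible ha
  obtain ⟨b', hb', hνb⟩ := h.exists_tangible hb
  obtain ⟨c', hc', hνc⟩ := h.exists_tangible hc
  by_contra hne
  have hsum : c' * (a' + b') = ν (c' * a') := by
    rw [mul_add]
    exact h.addEq _ _ (by rw [h.mulMap, h.mulMap, hνa, hνb, hνc, ← h.mulMap, ← h.mulMap, habc])
  rcases h.addNe a' b' (by rwa [hνa, hνb]) with h1 | h1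
  · exact h.mulTangible c' a' hc' ha' ⟨c' * a', by rw [← hsum, h1]⟩
  · exact h.mulTangible c' b' hc' hb' ⟨c' * a', by rw [← hsum, h1]⟩

theorem nuLE_of_mul_left (h : IsSupertropicalDomain ν) {a b c : R} (hc : c ≠ 0)
    (habc : NuLE ν (c * a) (c * b)) : NuLE ν a b := by
  rcases h.nuLE_total a b with hab | hba
  · exact hab
  · exact h.nuLE_of_map_eq
      (h.map_eq_of_mul_left hc (nuLE_antisymm habc (h.mul_nuLE_mul_left c hba)))

theorem nuLE_of_pow (h : IsSupertropicalDomain ν) {a b : R} {m : ℕ} (hm : m ≠ 0)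
    (hab : NuLE ν (a ^ m) (b ^ m)) : NuLE ν a b := by
  by_cases ha : a = 0
  · rw [ha]
    exact h.zero_nuLE b
  rcases h.nuLE_total a b with hle | hba
  · exact hle
  induction m with
  | zero => exact absurd rfl hm
  | succ m ih =>
    by_cases hm0 : m = 0
    · simpa [hm0] using hab
    refine ih hm0 (h.nuLE_of_mul_left ha ?_)
    rw [pow_succ', pow_succ'] at hab
    exact nuLE_trans hab (h.mul_nuLE_mul hba (h.nuLE_refl _))

theorem pow_ne_zero (h : IsSupertropicalDomain ν) {a : R} (ha : a ≠ 0) (m : ℕ) :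
    a ^ m ≠ 0 := by
  induction m with
  | zero =>
    rw [pow_zero]
    exact h.ne_zero_of_tangible h.oneTangible
  | succ m ih =>
    rw [pow_succ]
    exact h.mul_ne_zero ih ha

end IsSupertropicalDomain

section SemiIdempotent

open IsSupertropical

variable {R : Type*} [CommSemiring R] {ν : R → R} {m : Type*} [Fintype m] [DecidableEq m]
  {A : Matrix m m R} {β : R}

theorem Matrix.pow_succ_of_mul_self_eq_smul (hA : A * A = β • A) (p : ℕ) :
    A ^ (p + 1) = β ^ p • A := by
  induction p with
  | zero => simp
  | succ p ih => rw [pow_succ, ih, Matrix.smul_mul, hA, smul_smul, ← pow_succ]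

/-- A nonzero semi-idempotent matrix has a diagonal entry dominating the scalar. -/
theorem nuLE_trace_of_entry_ne_zero (h : IsSupertropicalDomain ν) (hβ : β ≠ 0)
    (hA : A * A = β • A) {i k : m} (hik : A i k ≠ 0) : NuLE ν β (∑ j, A j j) := by
  have hstep (i : m) : ∃ j, NuLE ν (β * A i k) (A i j * A j k) := by
    obtain ⟨j, -, hj⟩ := h.exists_sum_nuLE ⟨i, Finset.mem_univ i⟩ fun j => A i j * A j k
    refine ⟨j, ?_⟩
    rwa [← Matrix.mul_apply, hA, Matrix.smul_apply, smul_eq_mul] at hj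
  choose f hf using hstep
  have hne (t : ℕ) : A (f^[t] i) k ≠ 0 := by
    induction t with
    | zero => exact hik
    | succ t ih =>
      intro h0
      rw [Function.iterate_succ_apply'] at h0
      have := hf (f^[t] i)
      rw [h0, mul_zero] at this
      exact h.mul_ne_zero hβ ih (h.eq_zero_of_nuLE_zero this)
  have hiter (v : m) (p : ℕ) :
      NuLE ν (β ^ p * A v k) ((A ^ p) v (f^[p] v) * A (f^[p] v) k) := by
    induction p with
    | zero => simpa using h.nuLE_refl (A v k)
    | succ p ih =>
      rw [pow_succ', mul_assoc]
      refine nuLE_trans (h.mul_nuLE_mul_left β ih) ?_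
      rw [mul_left_comm]
      refine nuLE_trans (h.mul_nuLE_mul_left _ (hf _)) ?_
      rw [← mul_assoc, Function.iterate_succ_apply', pow_succ]
      exact h.mul_nuLE_mul (h.entry_mul_nuLE _ _ _ _ _) (h.nuLE_refl _)
  obtain ⟨v, p, hv, hp⟩ : ∃ v p, A v k ≠ 0 ∧ f^[p + 1] v = v := by
    obtain ⟨a, b, hab, heq⟩ := Finite.exists_ne_map_eq_of_infinite fun t : ℕ => f^[t] i
    wlog hlt : a < b generalizing a b
    · exact this b a hab.symm heq.symm (by omega)
    obtain ⟨p, rfl⟩ := Nat.exists_eq_add_of_lt hlt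
    refine ⟨f^[a] i, p, hne a, ?_⟩
    rw [← Function.iterate_add_apply]
    simpa only [add_comm, add_left_comm, add_assoc] using heq.symm
  have hcycle := hiter v (p + 1)
  rw [hp, Matrix.pow_succ_of_mul_self_eq_smul hA, Matrix.smul_apply, smul_eq_mul, pow_succ,
    mul_comm, mul_comm _ (A v k)] at hcycle
  exact nuLE_trans (h.nuLE_of_mul_left (h.pow_ne_zero hβ p) (h.nuLE_of_mul_left hv hcycle))
    (h.nuLE_sum (fun j => A j j) (Finset.mem_univ v))

theorem diag_pow_nuLE_trace_pow (h : IsSupertropicalDomain ν) (hβ : β ≠ 0)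
    (hA : A * A = β • A) (i : m) {p : ℕ} (hp : p ≠ 0) :
    NuLE ν ((A ^ p) i i) ((∑ j, A j j) ^ p) := by
  obtain ⟨p, rfl⟩ := Nat.exists_eq_succ_of_ne_zero hp
  rw [Nat.succ_eq_add_one, Matrix.pow_succ_of_mul_self_eq_smul hA, Matrix.smul_apply,
    smul_eq_mul, pow_succ]
  by_cases hi : A i i = 0
  · rw [hi, mul_zero]
    exact h.zero_nuLE _
  · exact h.mul_nuLE_mul (h.pow_nuLE_pow (nuLE_trace_of_entry_ne_zero h hβ hA hi) p)
      (h.nuLE_sum (fun j => A j j) (Finset.mem_univ i))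

theorem prod_perm_nuLE_trace_pow (h : IsSupertropicalDomain ν) (hβ : β ≠ 0)
    (hA : A * A = β • A) (σ : Equiv.Perm m) (s : Finset m) (hs : ∀ i, σ i ∈ s ↔ i ∈ s) :
    NuLE ν (∏ i ∈ s, A i (σ i)) ((∑ j, A j j) ^ s.card) := by
  have hN : orderOf σ ≠ 0 := (orderOf_pos σ).ne'
  have hpow (t : ℕ) (i : m) : (σ ^ t) i ∈ s ↔ i ∈ s := by
    induction t with
    | zero => simp
    | succ t ih => rw [pow_succ', Equiv.Perm.mul_apply, hs, ih]
  have hshift (t : ℕ) :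
      ∏ i ∈ s, A ((σ ^ t) i) ((σ ^ (t + 1)) i) = ∏ i ∈ s, A i (σ i) :=
    Finset.prod_equiv (σ ^ t) (fun i => (hpow t i).symm)
      fun i _ => by rw [pow_succ', Equiv.Perm.mul_apply]
  have hprod : (∏ i ∈ s, A i (σ i)) ^ orderOf σ =
      ∏ i ∈ s, ∏ t ∈ Finset.range (orderOf σ), A ((σ ^ t) i) ((σ ^ (t + 1)) i) := by
    rw [Finset.prod_comm, Finset.prod_congr rfl fun t _ => hshift t, Finset.prod_const,
      Finset.card_range]
  refine h.nuLE_of_pow hN ?_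
  rw [hprod, ← pow_mul, mul_comm, pow_mul, ← Finset.prod_const]
  refine h.prod_nuLE_prod fun i _ => ?_
  have hwalk := h.walk_nuLE A (fun t => (σ ^ t) i) (orderOf σ)
  simp only [pow_orderOf_eq_one, pow_zero, Equiv.Perm.one_apply] at hwalk
  exact nuLE_trans hwalk (diag_pow_nuLE_trace_pow h hβ hA i hN)

theorem stCharPoly_coeff_nuLE (h : IsSupertropicalDomain ν) (hβ : β ≠ 0)
    (hA : A * A = β • A) {k : ℕ} (hk : k ≤ Fintype.card m) :
    NuLE ν ((stCharPoly A).coeff (Fintype.card m - k)) ((∑ j, A j j) ^ k) := by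
  rw [stCharPoly, Polynomial.finsetSum_coeff]
  refine h.sum_nuLE fun σ _ => ?_
  rw [Finset.prod_add, Polynomial.finsetSum_coeff]
  refine h.sum_nuLE fun s _ => ?_
  rw [← map_prod, Polynomial.coeff_mul_C]
  by_cases hfix : ∀ i ∈ s, i = σ i
  · rw [Finset.prod_congr rfl fun i hi => if_pos (hfix i hi), Finset.prod_const,
      Polynomial.coeff_X_pow]
    split_ifs with hcard
    · have hcompl : (Finset.univ \ s).card = k := by
        rw [Finset.card_sdiff_of_subset (Finset.subset_univ s), Finset.card_univ]
        omega
      have hs (i : m) : σ i ∈ Finset.univ \ s ↔ i ∈ Finset.univ \ s := by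
        simp only [Finset.mem_sdiff, Finset.mem_univ, true_and, not_iff_not]
        exact ⟨fun hi => σ.injective (hfix _ hi) ▸ hi, fun hi => hfix i hi ▸ hi⟩
      rw [one_mul, ← hcompl]
      exact prod_perm_nuLE_trace_pow h hβ hA σ _ hs
    · rw [zero_mul]
      exact h.zero_nuLE _
  · push Not at hfix
    obtain ⟨i, hi, hne⟩ := hfix
    rw [Finset.prod_eq_zero hi (if_neg hne), Polynomial.coeff_zero, zero_mul]
    exact h.zero_nuLE _

end SemiIdempotent

/-- Lemma 4.21: over a supertropical domain, if `A` is semi-idempotent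
(`A² = β·A` with `β` tangible), then `μ(A) = 1`: writing `f_A = λ^n + Σ α_k λ^{n-k}` with
`α_1 = trace(A)`, one has `trace(A)^k ≥ν α_k` for each `1 ≤ k ≤ n`. -/
theorem semiIdempotent_mu_eq_one {R : Type*} [CommSemiring R] (ν : R → R)
    (hST : IsSupertropicalDomain ν) {n : ℕ} (A : Matrix (Fin n) (Fin n) R)
    (β : R) (hβ : β ∉ Set.range ν) (hsi : A * A = β • A) :
    ∀ k : ℕ, 1 ≤ k → k ≤ n →
      ν ((∑ i, A i i) ^ k) + ν ((stCharPoly A).coeff (n - k)) = ν ((∑ i, A i i) ^ k) := by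
  intro k _ hk
  simpa [NuLE] using
    stCharPoly_coeff_nuLE hST (hST.ne_zero_of_tangible hβ) hsi (by simpa using hk)
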